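/- Assume the minimal-type condition: ξ(σ(β)) ≥ 0 for every β ∈ R with ξ(β) > 0 and σ(β) ≠ −β. Then every β ∈ Q with σ(β) ∉ Q whose Levi order q^σ(β) is finite satisfies q^σ(β) ≤ 2. (In particular, a real orbit of the minimal type is either holomorphically degenerate or has Levi order at most 2.) -/

import Mathlib

open RealInnerProductSpace

variable {V : Type*} [NormedAddCommGroup V] [InnerProductSpace ℝ V]

/-- `R` is a reduced crystallographic root system in `V`. -/
def IsRootSystem (R : Set V) : Prop :=
  R.Finite ∧ (0 : V) ∉ R ∧
    (∀ α ∈ R, ∀ β ∈ R,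
      (∃ n : ℤ, 2 * ⟪β, α⟫ / ⟪α, α⟫ = (n : ℝ)) ∧
        β - (2 * ⟪β, α⟫ / ⟪α, α⟫) • α ∈ R) ∧
    ∀ α ∈ R, ∀ t : ℝ, t • α ∈ R → t = 1 ∨ t = -1

/-- The partial sum `β + α₁ + ⋯ + α_h` of the first `h` terms of a sequence. -/
def partialSum (β : V) {k : ℕ} (α : Fin k → V) (h : ℕ) : V :=
  β + ∑ i ∈ Finset.univ.filter (fun i : Fin k => (i : ℕ) < h), α i

/-- `α` is a Levi chain of length `k` for `β`: all `σ(αᵢ) ∈ Q`, all partial sums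
`β + α₁ + ⋯ + α_h` (`1 ≤ h ≤ k`) are roots, and the final sum `γ` satisfies
`γ ∉ Q` and `σ(γ) ∉ Q`. -/
def IsLeviChain (R Q : Set V) (σ : V →ₗ[ℝ] V) (β : V) {k : ℕ} (α : Fin k → V) : Prop :=
  (∀ i, α i ∈ R ∧ σ (α i) ∈ Q) ∧
    (∀ h : ℕ, 1 ≤ h → h ≤ k → partialSum β α h ∈ R) ∧
    partialSum β α k ∉ Q ∧ σ (partialSum β α k) ∉ Q

/-- The Levi order `q^σ(β)`: the minimal length of a Levi chain for `β`,
or `⊤` if no Levi chain for `β` exists. -/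
noncomputable def leviOrder (R Q : Set V) (σ : V →ₗ[ℝ] V) (β : V) : ℕ∞ :=
  sInf {m : ℕ∞ | ∃ (k : ℕ) (α : Fin k → V), m = (k : ℕ∞) ∧ IsLeviChain R Q σ β α}

namespace IsRootSystem

variable {R : Set V}

theorem neg_mem (hR : IsRootSystem R) {u : V} (hu : u ∈ R) : -u ∈ R := by
  have h0 : u ≠ 0 := fun h => hR.2.1 (h ▸ hu)
  have h := (hR.2.2.1 u hu u hu).2
  rw [mul_div_assoc, div_self (inner_self_ne_zero.2 h0), mul_one, two_smul] at h
  simpa using h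

/-- In a root system, the Cartan integer of two roots `u`, `v` at an obtuse angle is either
`-1`, in which case `u + v` is a root, or at most `-2`. -/
theorem add_mem_or_inner_le (hR : IsRootSystem R) {u v : V} (hu : u ∈ R) (hv : v ∈ R)
    (h : ⟪u, v⟫ < 0) : u + v ∈ R ∨ ⟪u, v⟫ ≤ -⟪v, v⟫ := by
  have hv0 : v ≠ 0 := fun h => hR.2.1 (h ▸ hv)
  have hpos : 0 < ⟪v, v⟫ := real_inner_self_pos.2 hv0
  obtain ⟨⟨n, hn⟩, hmem⟩ := hR.2.2.1 v hv u hu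
  have hneg : (n : ℝ) < 0 := by
    rw [← hn]
    exact div_neg_of_neg_of_pos (by linarith) hpos
  have hneg' : n < 0 := by exact_mod_cast hneg
  rcases eq_or_ne n (-1) with h1 | h1
  · left
    rw [hn, h1] at hmem
    simpa using hmem
  · right
    have h2 : (n : ℝ) ≤ -2 := by exact_mod_cast (by omega : n ≤ -2)
    rw [← hn, div_le_iff₀ hpos] at h2
    linarith

theorem add_mem (hR : IsRootSystem R) {u v : V} (hu : u ∈ R) (hv : v ∈ R)
    (h : ⟪u, v⟫ < 0) (hne : u + v ≠ 0) : u + v ∈ R := by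
  rcases hR.add_mem_or_inner_le hu hv h with h1 | h1
  · exact h1
  rcases hR.add_mem_or_inner_le hv hu (by rwa [real_inner_comm]) with h2 | h2
  · rwa [add_comm]
  have h3 : 0 < ⟪u + v, u + v⟫ := real_inner_self_pos.2 hne
  rw [real_inner_add_add_self] at h3
  rw [real_inner_comm] at h2
  linarith

theorem sub_mem (hR : IsRootSystem R) {u v : V} (hu : u ∈ R) (hv : v ∈ R)
    (h : 0 < ⟪u, v⟫) (hne : u ≠ v) : u - v ∈ R := by
  rw [sub_eq_add_neg]
  refine hR.add_mem hu (hR.neg_mem hv) (by rw [inner_neg_right]; linarith) ?_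
  rwa [← sub_eq_add_neg, sub_ne_zero]

/-- A combinatorial form of the Jacobi identity. -/
theorem add_mem_or_add_mem (hR : IsRootSystem R) {u v w : V} (hu : u ∈ R) (hv : v ∈ R)
    (hw : w ∈ R) (huv : u + v ∈ R) (huvw : u + v + w ∈ R) (hvw : v + w ≠ 0)
    (huw : u + w ≠ 0) : v + w ∈ R ∨ u + w ∈ R := by
  by_contra! hcon
  obtain ⟨h1, h2⟩ := hcon
  have e1 : 0 ≤ ⟪v, w⟫ := not_lt.1 fun h => h1 (hR.add_mem hv hw h hvw)
  have e2 : 0 ≤ ⟪u, w⟫ := not_lt.1 fun h => h2 (hR.add_mem hu hw h huw)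
  have e3 : ⟪u + v + w, v⟫ ≤ 0 := not_lt.1 fun h => h2 <| by
    have := hR.sub_mem huvw hv h (fun h => huw (by rwa [add_right_comm, add_eq_right] at h))
    rwa [show u + v + w - v = u + w by abel] at this
  have e4 : ⟪u + v + w, u⟫ ≤ 0 := not_lt.1 fun h => h1 <| by
    have := hR.sub_mem huvw hu h (fun h => hvw (by rwa [add_assoc, add_eq_left] at h))
    rwa [show u + v + w - u = v + w by abel] at this
  have h0 : u + v ≠ 0 := fun h => hR.2.1 (h ▸ huv)
  have e5 : 0 < ⟪u + v, u + v⟫ := real_inner_self_pos.2 h0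
  rw [real_inner_add_add_self] at e5
  simp only [inner_add_left] at e3 e4
  rw [real_inner_comm v w] at e3
  rw [real_inner_comm u w, real_inner_comm u v] at e4
  linarith

end IsRootSystem

/-- Levi chains as lists, by recursion on the first step. -/
def IsLeviList (R : Set V) (ξ : V →ₗ[ℝ] ℝ) (σ : V →ₗ[ℝ] V) : V → List V → Prop
  | β, [] => 0 < ξ β ∧ 0 < ξ (σ β)
  | β, x :: L => (x ∈ R ∧ ξ (σ x) ≤ 0) ∧ β + x ∈ R ∧ IsLeviList R ξ σ (β + x) L

omit [InnerProductSpace ℝ V] in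
theorem partialSum_zero (β : V) {k : ℕ} (α : Fin k → V) : partialSum β α 0 = β := by
  simp [partialSum]

omit [InnerProductSpace ℝ V] in
theorem partialSum_succ (β : V) {k : ℕ} (α : Fin (k + 1) → V) (h : ℕ) :
    partialSum β α (h + 1) = partialSum (β + α 0) (fun i => α i.succ) h := by
  simp [partialSum, Finset.sum_filter, Fin.sum_univ_succ, add_assoc]

theorem isLeviChain_succ {R Q : Set V} {σ : V →ₗ[ℝ] V} {β : V} {k : ℕ} {α : Fin (k + 1) → V} :
    IsLeviChain R Q σ β α ↔ (α 0 ∈ R ∧ σ (α 0) ∈ Q) ∧ β + α 0 ∈ R ∧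
      IsLeviChain R Q σ (β + α 0) (fun i => α i.succ) := by
  unfold IsLeviChain
  rw [Fin.forall_fin_succ, partialSum_succ]
  constructor
  · rintro ⟨⟨h0, h1⟩, h2, h3⟩
    refine ⟨h0, ?_, h1, fun h hh hk => ?_, h3⟩
    · simpa [partialSum_succ, partialSum_zero] using h2 1 le_rfl (by omega)
    · simpa [partialSum_succ] using h2 (h + 1) (by omega) (by omega)
  · rintro ⟨h0, h0', h1, h2, h3⟩
    refine ⟨⟨h0, h1⟩, fun h hh hk => ?_, h3⟩
    obtain ⟨h, rfl⟩ := Nat.exists_eq_add_of_le' hh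
    rw [partialSum_succ]
    rcases h.eq_zero_or_pos with rfl | hpos
    · rwa [partialSum_zero]
    · exact h2 h hpos (by omega)

section LeviList

variable {R : Set V} {ξ : V →ₗ[ℝ] ℝ} {σ : V →ₗ[ℝ] V}

theorem isLeviChain_iff_isLeviList (hσR : ∀ x ∈ R, σ x ∈ R) {k : ℕ} :
    ∀ {β : V} {α : Fin k → V}, β ∈ R →
      (IsLeviChain R {α ∈ R | ξ α ≤ 0} σ β α ↔ IsLeviList R ξ σ β (List.ofFn α)) := by
  induction k with
  | zero =>
    intro β α hβ
    simp +contextual [IsLeviChain, IsLeviList, partialSum_zero, hβ, hσR β hβ]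
  | succ k ih =>
    intro β α hβ
    rw [isLeviChain_succ, List.ofFn_succ, IsLeviList]
    refine and_congr ?_ (and_congr_right fun h => ih h)
    exact and_congr_right fun h => by simp [hσR _ h]

namespace IsLeviList

theorem exists_isLeviChain (hσR : ∀ x ∈ R, σ x ∈ R) {β : V} (hβ : β ∈ R) {L : List V}
    (h : IsLeviList R ξ σ β L) :
    IsLeviChain R {α ∈ R | ξ α ≤ 0} σ β L.get := by
  rw [isLeviChain_iff_isLeviList hσR hβ, List.ofFn_get]
  exact h

theorem right_pos {β : V} {L : List V} (h : IsLeviList R ξ σ β L) : 0 < ξ (σ β) := by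
  induction L generalizing β with
  | nil => exact h.2
  | cons x L ih =>
    have h1 := ih h.2.2
    have h2 := h.1.2
    simp only [map_add] at h1
    linarith

theorem mem_step {β : V} {L : List V} (h : IsLeviList R ξ σ β L) :
    ∀ x ∈ L, x ∈ R ∧ ξ (σ x) ≤ 0 := by
  induction L generalizing β with
  | nil => simp
  | cons x L ih => exact List.forall_mem_cons.2 ⟨h.1, ih h.2.2⟩

theorem exists_pos {β : V} {L : List V} (h : IsLeviList R ξ σ β L) (hβ : ξ β ≤ 0) :
    ∃ x ∈ L, 0 < ξ x := by
  by_contra! hcon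
  induction L generalizing β with
  | nil => exact hβ.not_gt h.1
  | cons x L ih =>
    refine ih h.2.2 ?_ fun y hy => hcon y (List.mem_cons_of_mem _ hy)
    rw [map_add]
    linarith [hcon x List.mem_cons_self]

/-- A Levi chain from a root on which `ξ + ξ ∘ σ` is nonpositive contains a step on which
`ξ + ξ ∘ σ` is positive. -/
theorem exists_add_pos {β : V} {L : List V} (h : IsLeviList R ξ σ β L)
    (hβ : ξ β + ξ (σ β) ≤ 0) : ∃ x ∈ L, 0 < ξ x + ξ (σ x) := by
  by_contra! hcon
  induction L generalizing β with
  | nil => linarith [h.1, h.2]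
  | cons x L ih =>
    refine ih h.2.2 ?_ fun y hy => hcon y (List.mem_cons_of_mem _ hy)
    simp only [map_add]
    linarith [hcon x List.mem_cons_self]

theorem swap (hR : IsRootSystem R) {β x y : V} {L : List V} (hβ : β ∈ R)
    (h : IsLeviList R ξ σ β (x :: y :: L)) :
    IsLeviList R ξ σ β (y :: x :: L) ∨
      ∃ L', L'.length < (x :: y :: L).length ∧ IsLeviList R ξ σ β L' := by
  obtain ⟨⟨hx, hx'⟩, hβx, ⟨hy, hy'⟩, hβxy, hL⟩ := h
  by_cases hxy : x + y = 0
  · refine .inr ⟨L, by simp only [List.length_cons]; omega, ?_⟩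
    rwa [add_assoc, hxy, add_zero] at hL
  have hβy : β + y ≠ 0 := by
    intro h0
    have h1 := hL.right_pos
    rw [add_right_comm, h0, zero_add] at h1
    linarith
  rcases hR.add_mem_or_add_mem hβ hx hy hβx hβxy hxy hβy with h1 | h1
  · refine .inr ⟨(x + y) :: L, by simp, ⟨h1, ?_⟩, ?_, ?_⟩
    · simp only [map_add]
      linarith
    · rwa [← add_assoc]
    · rwa [← add_assoc]
  · refine .inl ⟨⟨hy, hy'⟩, h1, ⟨hx, hx'⟩, ?_, ?_⟩
    · rwa [add_right_comm]
    · rwa [add_right_comm]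

/-- The steps of a Levi chain of minimal length can be arbitrarily permuted. -/
theorem perm (hR : IsRootSystem R) {L L' : List V} (hp : L.Perm L') :
    ∀ {β : V}, β ∈ R → IsLeviList R ξ σ β L →
      (∀ M, IsLeviList R ξ σ β M → L.length ≤ M.length) → IsLeviList R ξ σ β L' := by
  induction hp with
  | nil => exact fun _ h _ => h
  | cons x _ ih =>
    intro β _ h hmin
    refine ⟨h.1, h.2.1, ih h.2.1 h.2.2 fun M hM => ?_⟩
    simpa using hmin (x :: M) ⟨h.1, h.2.1, hM⟩
  | swap x y L =>
    intro β hβ h hmin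
    rcases h.swap hR hβ with h | ⟨M, hlt, hM⟩
    · exact h
    · exact absurd (hmin M hM) hlt.not_ge
  | trans hp₁ _ ih₁ ih₂ =>
    intro β hβ h hmin
    exact ih₂ hβ (ih₁ hβ h hmin) (hp₁.length_eq ▸ hmin)

theorem exists_cons_of_mem (hR : IsRootSystem R) {β x : V} {L : List V} (hβ : β ∈ R)
    (h : IsLeviList R ξ σ β L) (hmin : ∀ M, IsLeviList R ξ σ β M → L.length ≤ M.length)
    (hx : x ∈ L) : ∃ L', L.length = L'.length + 1 ∧ IsLeviList R ξ σ β (x :: L') := by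
  obtain ⟨s, t, rfl⟩ := List.append_of_mem hx
  exact ⟨s ++ t, by simp; omega, h.perm hR List.perm_middle hβ hmin⟩

theorem length_le_one (hR : IsRootSystem R) {β : V} {L : List V} (hβ : β ∈ R)
    (h : IsLeviList R ξ σ β L) (hmin : ∀ M, IsLeviList R ξ σ β M → L.length ≤ M.length)
    (hξ : ξ β = 0) : L.length ≤ 1 := by
  obtain ⟨x, hxL, hx⟩ := h.exists_pos hξ.le
  obtain ⟨L', -, hL'⟩ := h.exists_cons_of_mem hR hβ hmin hxL
  refine hmin [x] ⟨hL'.1, hL'.2.1, ?_, hL'.2.2.right_pos⟩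
  rw [map_add]
  linarith

theorem length_le_two (hR : IsRootSystem R)
    (hσ : ∀ β ∈ R, 0 < ξ β → σ β ≠ -β → 0 ≤ ξ (σ β)) {β : V} {L : List V} (hβ : β ∈ R)
    (h : IsLeviList R ξ σ β L) (hmin : ∀ M, IsLeviList R ξ σ β M → L.length ≤ M.length)
    (hξ : ξ β ≤ 0) : L.length ≤ 2 := by
  have himag : ∀ γ ∈ R, ξ γ < 0 → 0 < ξ (σ γ) → ξ (σ γ) = -ξ γ := by
    intro γ hγ h1 h2
    by_contra hne
    have h3 := hσ (-γ) (hR.neg_mem hγ) (by rw [map_neg]; linarith) (fun h0 => hne <| by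
      rw [map_neg, neg_inj] at h0
      rw [h0, map_neg])
    rw [map_neg, map_neg] at h3
    linarith
  rcases hξ.eq_or_lt with hξ0 | hξ0
  · exact (h.length_le_one hR hβ hmin hξ0).trans one_le_two
  have hβ' := himag β hβ hξ0 h.right_pos
  obtain ⟨x, hxL, hx⟩ := h.exists_add_pos (by linarith)
  obtain ⟨hxR, hxσ⟩ := h.mem_step x hxL
  have hσx : ξ (σ x) = 0 := by
    refine hxσ.antisymm (hσ x hxR (by linarith) fun h0 => ?_)
    rw [h0, map_neg] at hx
    linarith
  obtain ⟨L', hlen, hL'⟩ := h.exists_cons_of_mem hR hβ hmin hxL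
  have hmin' : ∀ M, IsLeviList R ξ σ (β + x) M → L'.length ≤ M.length := by
    intro M hM
    have := hmin (x :: M) ⟨hL'.1, hL'.2.1, hM⟩
    rw [List.length_cons] at this
    omega
  have hle : L'.length ≤ 1 := by
    rcases lt_trichotomy (ξ (β + x)) 0 with h1 | h1 | h1
    · have h2 := himag _ hL'.2.1 h1 hL'.2.2.right_pos
      simp only [map_add] at h2
      linarith
    · exact hL'.2.2.length_le_one hR hL'.2.1 hmin' h1
    · exact (hmin' [] ⟨h1, hL'.2.2.right_pos⟩).trans zero_le_one
  omega

end IsLeviList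

end LeviList

/-- Under the minimal-type condition, every `β ∈ Q` with `σ(β) ∉ Q` of finite
Levi order has `q^σ(β) ≤ 2`: a real orbit of the minimal type is either
holomorphically degenerate or has Levi order at most `2`. -/
theorem leviOrder_le_two_of_minimalType
    (R : Set V) (hR : IsRootSystem R)
    (ξ : V →ₗ[ℝ] ℝ) (hξ : ∀ α ∈ R, ∃ n : ℤ, ξ α = (n : ℝ))
    (Q : Set V) (hQ : Q = {α ∈ R | ξ α ≤ 0})
    (σ : V →ₗ[ℝ] V) (hσ : σ ∘ₗ σ = LinearMap.id) (hσR : σ '' R = R)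
    (hmin : ∀ β ∈ R, 0 < ξ β → σ β ≠ -β → 0 ≤ ξ (σ β)) :
    ∀ β ∈ Q, σ β ∉ Q → leviOrder R Q σ β ≠ ⊤ → leviOrder R Q σ β ≤ 2 := by
  subst hQ
  intro β hβ _ hfin
  have hσR' : ∀ x ∈ R, σ x ∈ R := fun x hx => hσR ▸ Set.mem_image_of_mem σ hx
  have hex : ∃ n, ∃ L : List V, L.length = n ∧ IsLeviList R ξ σ β L := by
    by_contra! hcon
    refine hfin (sInf_eq_top.2 ?_)
    rintro _ ⟨k, α, rfl, hα⟩
    exact absurd ((isLeviChain_iff_isLeviList hσR' hβ.1).1 hα) (hcon _ _ rfl)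
  classical
  obtain ⟨L, hlen, hL⟩ := Nat.find_spec hex
  have hle := hL.length_le_two hR hmin hβ.1
    (fun M hM => hlen ▸ Nat.find_min' hex ⟨M, rfl, hM⟩) hβ.2
  calc leviOrder R {α ∈ R | ξ α ≤ 0} σ β ≤ (L.length : ℕ∞) :=
        sInf_le ⟨_, _, rfl, hL.exists_isLeviChain hσR' hβ.1⟩
    _ ≤ 2 := by exact_mod_cast hle
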